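/- arXiv:1605.06912 — 2 statements merged into one kernel-verified Lean document; each statement's English description precedes it below -/
import Mathlib

section
/- Let 0 < α < 1, x > 0, and let y be smooth (C^∞) on [0, x] with y(0) = y'(0) = y''(0) = 0. Then there exists C > 0 (independent of n) such that for all integers n ≥ 2, with h = x/n, | (1/(Γ(−α)h^α)) ( Σ_{k=1}^{n−1} y(x−kh)/k^{1+α} − ζ(1+α) y(x) ) − D^α y(x) + (ζ(α)/Γ(−α)) y'(x) h^{1−α} − (ζ(α−1)/(2Γ(−α))) y''(x) h^{2−α} | ≤ C h^{3−α}. -/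
/-- Real values of the Riemann zeta function at real arguments
(real part of the analytic continuation). -/
noncomputable def zr (s : ℝ) : ℝ := (riemannZeta s).re

/-- The Caputo derivative of order `α` of `y` at `x`. -/
noncomputable def caputo (α : ℝ) (y : ℝ → ℝ) (x : ℝ) : ℝ :=
  (1 / Real.Gamma (1 - α)) * ∫ t in (0:ℝ)..x, deriv y t / (x - t) ^ α

theorem norm_correctedTrapezoid_sub_le {E : Type*} [NormedAddCommGroup E] [NormedSpace ℝ E]
    {Φ φ φ₁ φ₂ φ₃ : ℝ → E} {a h M : ℝ} (hh : 0 ≤ h)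
    (hΦ : ∀ t ∈ Set.Icc a (a + h), HasDerivAt Φ (φ t) t)
    (hφ : ∀ t ∈ Set.Icc a (a + h), HasDerivAt φ (φ₁ t) t)
    (hφ₁ : ∀ t ∈ Set.Icc a (a + h), HasDerivAt φ₁ (φ₂ t) t)
    (hφ₂ : ∀ t ∈ Set.Icc a (a + h), HasDerivAt φ₂ (φ₃ t) t)
    (hM : ∀ t ∈ Set.Icc a (a + h), ‖φ₃ t‖ ≤ M) :
    ‖(h / 2) • (φ a + φ (a + h)) - (Φ (a + h) - Φ a) - (h ^ 2 / 12) • (φ₁ (a + h) - φ₁ a)‖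
      ≤ M * h ^ 4 / 4 := by
  have hM0 : 0 ≤ M := (norm_nonneg _).trans (hM a ⟨le_rfl, by linarith⟩)
  have mvt : ∀ {F F' : ℝ → E} {C : ℝ}, 0 ≤ C → F 0 = 0 →
      (∀ t ∈ Set.Icc 0 h, HasDerivAt F (F' t) t) → (∀ t ∈ Set.Icc 0 h, ‖F' t‖ ≤ C) →
      ∀ t ∈ Set.Icc 0 h, ‖F t‖ ≤ C * h := by
    intro F F' C hC hF0 hF hb t ht
    have := (convex_Icc 0 h).norm_image_sub_le_of_norm_hasDerivWithin_le
      (fun u hu => (hF u hu).hasDerivWithinAt) hb ⟨le_rfl, hh⟩ ht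
    rw [hF0, sub_zero, sub_zero, Real.norm_of_nonneg ht.1] at this
    exact this.trans (mul_le_mul_of_nonneg_left ht.2 hC)
  have mem : ∀ t ∈ Set.Icc 0 h, a + t ∈ Set.Icc a (a + h) := fun t ht =>
    ⟨by linarith [ht.1], by linarith [ht.2]⟩
  have shift : ∀ {F F' : ℝ → E}, (∀ t ∈ Set.Icc a (a + h), HasDerivAt F (F' t) t) →
      ∀ t ∈ Set.Icc 0 h, HasDerivAt (fun u => F (a + u)) (F' (a + t)) t := fun hF t ht =>
    (hF _ (mem t ht)).comp_const_add a t
  have dΦ := shift hΦ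
  have dφ := shift hφ
  have dφ₁ := shift hφ₁
  have dφ₂ := shift hφ₂
  have pid : ∀ t : ℝ, HasDerivAt (fun u : ℝ => u / 6) (1 / 6) t := fun t =>
    (hasDerivAt_id t).div_const 6
  have psq : ∀ t : ℝ, HasDerivAt (fun u : ℝ => u ^ 2 / 12) (t / 6) t := fun t => by
    convert! (hasDerivAt_pow 2 t).div_const 12 using 1
    ring
  have bound₀ : ∀ t ∈ Set.Icc 0 h, ‖(1 / 6 : ℝ) • (φ₁ a - φ₁ (a + t)) + (t / 6) • φ₂ (a + t)‖
      ≤ (M * h / 6) * h := by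
    refine mvt (F' := fun t => (t / 6) • φ₃ (a + t)) (by positivity) (by simp) ?_ ?_
    · intro t ht
      convert! (((dφ₁ t ht).const_sub (φ₁ a)).const_smul (1 / 6 : ℝ)).add
        ((pid t).smul (dφ₂ t ht)) using 1
      module
    · intro t ht
      rw [norm_smul, Real.norm_of_nonneg (by linarith [ht.1])]
      have := hM _ (mem t ht)
      calc t / 6 * ‖φ₃ (a + t)‖ ≤ h / 6 * M := by gcongr; exact ht.2
        _ = _ := by ring
  have bound₁ : ∀ t ∈ Set.Icc 0 h, ‖(1 / 2 : ℝ) • (φ a - φ (a + t)) + (t / 3) • φ₁ (a + t)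
      + (t / 6) • φ₁ a - (t ^ 2 / 12) • φ₂ (a + t)‖ ≤ (M * h ^ 2 / 4) * h := by
    refine mvt (F' := fun t => ((1 / 6 : ℝ) • (φ₁ a - φ₁ (a + t)) + (t / 6) • φ₂ (a + t))
      - (t ^ 2 / 12) • φ₃ (a + t)) (by positivity) (by simp) ?_ ?_
    · intro t ht
      convert! (((((dφ t ht).const_sub (φ a)).const_smul (1 / 2 : ℝ)).add
        (((hasDerivAt_id t).div_const 3).smul (dφ₁ t ht))).add
        ((pid t).smul_const (φ₁ a))).sub
        ((psq t).smul (dφ₂ t ht)) using 1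
      simp only [id]
      module
    · intro t ht
      refine (norm_sub_le _ _).trans ?_
      have h1 := bound₀ t ht
      have h2 : ‖(t ^ 2 / 12) • φ₃ (a + t)‖ ≤ h ^ 2 / 12 * M := by
        rw [norm_smul, Real.norm_of_nonneg (by positivity)]
        have := hM _ (mem t ht)
        have h0 := ht.1
        gcongr
        exact ht.2
      linarith
  have bound₂ : ∀ t ∈ Set.Icc 0 h, ‖(t / 2) • (φ a + φ (a + t)) - (Φ (a + t) - Φ a)
      - (t ^ 2 / 12) • (φ₁ (a + t) - φ₁ a)‖ ≤ (M * h ^ 3 / 4) * h := by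
    refine mvt (F' := fun t => (1 / 2 : ℝ) • (φ a - φ (a + t)) + (t / 3) • φ₁ (a + t)
      + (t / 6) • φ₁ a - (t ^ 2 / 12) • φ₂ (a + t)) (by positivity) (by simp) ?_ ?_
    · intro t ht
      convert! ((((hasDerivAt_id t).div_const 2).smul ((dφ t ht).const_add (φ a))).sub
        ((dΦ t ht).sub_const (Φ a))).sub
        ((psq t).smul ((dφ₁ t ht).sub_const (φ₁ a))) using 1
      simp only [id]
      module
    · intro t ht
      exact (bound₁ t ht).trans_eq (by ring)
  exact (bound₂ h ⟨hh, le_rfl⟩).trans_eq (by ring)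

/-- The error of the corrected trapezoidal rule for `t ↦ t ^ (-s)` on `[k + 1, k + 2]`. -/
noncomputable def zetaTrapezoidError (s : ℂ) (k : ℕ) : ℂ :=
  (((k + 1 : ℝ) : ℂ) ^ (-s) + ((k + 2 : ℝ) : ℂ) ^ (-s)) / 2
    - (((k + 2 : ℝ) : ℂ) ^ (1 - s) - ((k + 1 : ℝ) : ℂ) ^ (1 - s)) / (1 - s)
    + s / 12 * (((k + 2 : ℝ) : ℂ) ^ (-s - 1) - ((k + 1 : ℝ) : ℂ) ^ (-s - 1))

theorem hasDerivAt_ofReal_cpow_of_pos {t : ℝ} (ht : 0 < t) (r : ℂ) :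
    HasDerivAt (fun u : ℝ => (u : ℂ) ^ r) (r * (t : ℂ) ^ (r - 1)) t := by
  rcases eq_or_ne r 0 with rfl | hr
  · simpa using hasDerivAt_const t (1 : ℂ)
  · exact hasDerivAt_ofReal_cpow_const ht.ne' hr

theorem norm_zetaTrapezoidError_le {s : ℂ} (hs : s ≠ 1) (hre : -3 ≤ s.re) (k : ℕ) :
    ‖zetaTrapezoidError s k‖ ≤ ‖s * (s + 1) * (s + 2)‖ / 4 * (k + 1 : ℝ) ^ (-s.re - 3) := by
  have hs' : 1 - s ≠ 0 := sub_ne_zero.mpr hs.symm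
  have pos : ∀ t ∈ Set.Icc (k + 1 : ℝ) (k + 1 + 1), 0 < t := fun t ht =>
    lt_of_lt_of_le (by positivity) ht.1
  have key := norm_correctedTrapezoid_sub_le (a := k + 1) (h := 1)
    (Φ := fun t => (t : ℂ) ^ (1 - s) / (1 - s)) (φ := fun t => (t : ℂ) ^ (-s))
    (φ₁ := fun t => -s * (t : ℂ) ^ (-s - 1)) (φ₂ := fun t => s * (s + 1) * (t : ℂ) ^ (-s - 2))
    (φ₃ := fun t => -(s * (s + 1) * (s + 2)) * (t : ℂ) ^ (-s - 3))
    (M := ‖s * (s + 1) * (s + 2)‖ * (k + 1 : ℝ) ^ (-s.re - 3)) zero_le_one ?_ ?_ ?_ ?_ ?_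
  · convert! key using 1
    · congr 1
      simp only [zetaTrapezoidError, Complex.real_smul]
      push_cast
      rw [show (k : ℂ) + 1 + 1 = k + 2 by ring]
      ring
    · ring
  · intro t ht
    convert! (hasDerivAt_ofReal_cpow_of_pos (pos t ht) (1 - s)).div_const (1 - s) using 1
    rw [mul_div_cancel_left₀ _ hs']
    congr 1; ring
  · intro t ht
    exact hasDerivAt_ofReal_cpow_of_pos (pos t ht) (-s)
  · intro t ht
    convert! (hasDerivAt_ofReal_cpow_of_pos (pos t ht) (-s - 1)).const_mul (-s) using 1
    rw [show -s - 1 - 1 = -s - 2 by ring]; ring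
  · intro t ht
    convert! (hasDerivAt_ofReal_cpow_of_pos (pos t ht) (-s - 2)).const_mul (s * (s + 1)) using 1
    rw [show -s - 2 - 1 = -s - 3 by ring]; ring
  · intro t ht
    rw [norm_mul, norm_neg, Complex.norm_cpow_eq_rpow_re_of_pos (pos t ht)]
    gcongr ?_ * ?_
    have : (-s - 3).re = -s.re - 3 := by simp
    rw [this]
    exact Real.rpow_le_rpow_of_nonpos (by positivity) ht.1 (by linarith)

theorem sum_zetaTrapezoidError (s : ℂ) (N : ℕ) :
    ∑ k ∈ Finset.range N, zetaTrapezoidError s k =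
      ∑ k ∈ Finset.range N, ((k + 1 : ℝ) : ℂ) ^ (-s) - 1 / 2 + ((N + 1 : ℝ) : ℂ) ^ (-s) / 2
        - (((N + 1 : ℝ) : ℂ) ^ (1 - s) - 1) / (1 - s)
        + s / 12 * (((N + 1 : ℝ) : ℂ) ^ (-s - 1) - 1) := by
  induction N with
  | zero => simp
  | succ N ih =>
    rw [Finset.sum_range_succ, ih, Finset.sum_range_succ, zetaTrapezoidError]
    push_cast
    rw [show (N : ℂ) + 1 + 1 = N + 2 by ring]
    ring

theorem summable_add_one_rpow {p : ℝ} (hp : p < -1) : Summable fun k : ℕ => (k + 1 : ℝ) ^ p := by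
  have := (summable_nat_add_iff 1).mpr (Real.summable_nat_rpow.mpr hp)
  simpa using this

theorem summable_zetaTrapezoidError {s : ℂ} (hs : s ≠ 1) (hre : -2 < s.re) :
    Summable (zetaTrapezoidError s) :=
  Summable.of_norm_bounded ((summable_add_one_rpow (by linarith)).mul_left _)
    (norm_zetaTrapezoidError_le hs (by linarith))

theorem tendsto_ofReal_cpow_atTop {r : ℂ} (hr : r.re < 0) :
    Filter.Tendsto (fun N : ℕ => ((N + 1 : ℝ) : ℂ) ^ r) Filter.atTop (nhds 0) := by
  rw [tendsto_zero_iff_norm_tendsto_zero]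
  have h1 : Filter.Tendsto (fun N : ℕ => (N + 1 : ℝ)) Filter.atTop Filter.atTop :=
    Filter.tendsto_atTop_add_const_right _ _ tendsto_natCast_atTop_atTop
  have := (tendsto_rpow_neg_atTop (neg_pos.mpr hr)).comp h1
  refine this.congr fun N => ?_
  rw [Complex.norm_cpow_eq_rpow_re_of_pos (by positivity)]
  simp

theorem tsum_zetaTrapezoidError_of_one_lt_re {s : ℂ} (hs : 1 < s.re) :
    ∑' k, zetaTrapezoidError s k = riemannZeta s - 1 / 2 + 1 / (1 - s) - s / 12 := by
  have hs1 : s ≠ 1 := by rintro rfl; simp at hs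
  have h1 := (summable_zetaTrapezoidError hs1 (by linarith)).hasSum.tendsto_sum_nat
  have h2 : Filter.Tendsto (fun N => ∑ k ∈ Finset.range N, ((k + 1 : ℝ) : ℂ) ^ (-s))
      Filter.atTop (nhds (riemannZeta s)) := by
    rw [zeta_eq_tsum_one_div_nat_add_one_cpow hs]
    have : Summable fun n : ℕ => 1 / (n + 1 : ℂ) ^ s := by
      simpa using (summable_nat_add_iff 1).mpr (Complex.summable_one_div_nat_cpow.mpr hs)
    refine this.hasSum.tendsto_sum_nat.congr fun N => Finset.sum_congr rfl fun k _ => ?_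
    push_cast
    rw [Complex.cpow_neg, one_div]
  have e1 := tendsto_ofReal_cpow_atTop (r := -s) (by simp; linarith)
  have e2 := tendsto_ofReal_cpow_atTop (r := 1 - s) (by simp; linarith)
  have e3 := tendsto_ofReal_cpow_atTop (r := -s - 1) (by simp; linarith)
  have h3 := (((h2.sub_const (1 / 2)).add (e1.div_const 2)).sub
    ((e2.sub_const 1).div_const (1 - s))).add ((e3.sub_const 1).const_mul (s / 12))
  refine tendsto_nhds_unique (h1.congr (sum_zetaTrapezoidError s)) ?_
  convert! h3 using 2
  ring

theorem differentiableAt_zetaTrapezoidError {s : ℂ} (hs : s ≠ 1) (k : ℕ) :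
    DifferentiableAt ℂ (fun z => zetaTrapezoidError z k) s := by
  have hs' : 1 - s ≠ 0 := sub_ne_zero.mpr hs.symm
  have h1 : ((k + 1 : ℝ) : ℂ) ≠ 0 := by exact_mod_cast (by positivity : (k + 1 : ℝ) ≠ 0)
  have h2 : ((k + 2 : ℝ) : ℂ) ≠ 0 := by exact_mod_cast (by positivity : (k + 2 : ℝ) ≠ 0)
  have pw : ∀ {c : ℂ} {f : ℂ → ℂ}, c ≠ 0 → DifferentiableAt ℂ f s →
      DifferentiableAt ℂ (fun z => c ^ f z) s := fun hc hf => hf.const_cpow (Or.inl hc)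
  unfold zetaTrapezoidError
  refine (DifferentiableAt.sub ?_ ?_).add ?_
  · exact ((pw h1 (by fun_prop)).add (pw h2 (by fun_prop))).div_const 2
  · exact ((pw h2 (by fun_prop)).sub (pw h1 (by fun_prop))).div (by fun_prop) hs'
  · exact (by fun_prop : DifferentiableAt ℂ (fun z : ℂ => z / 12) s).mul
      ((pw h2 (by fun_prop)).sub (pw h1 (by fun_prop)))

theorem tsum_zetaTrapezoidError {σ : ℝ} (h₁ : -1 < σ) (h₂ : σ ≠ 1) :
    ∑' k, zetaTrapezoidError σ k = riemannZeta σ - 1 / 2 + 1 / (1 - σ) - σ / 12 := by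
  rcases lt_or_gt_of_ne h₂ with h₂ | h₂
  swap
  · exact tsum_zetaTrapezoidError_of_one_lt_re (by simpa using h₂)
  set U : Set ℂ := Metric.ball 2 3 ∩ {z | z.re - z.im < 1} with hU
  have hUo : IsOpen U := Metric.isOpen_ball.inter
    (isOpen_lt (Complex.continuous_re.sub Complex.continuous_im) continuous_const)
  have hUc : Convex ℝ U := (convex_ball _ _).inter
    (convex_halfSpace_lt ⟨fun a b => by simp; ring, fun c a => by simp; ring⟩ _)
  have hU1 : ∀ z ∈ U, z ≠ 1 := by
    rintro z ⟨-, hz⟩ rfl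
    simp at hz
  have hball : ∀ z ∈ U, -1 < z.re ∧ ‖z‖ ≤ 5 := by
    rintro z ⟨hz, -⟩
    rw [Metric.mem_ball, dist_eq_norm] at hz
    constructor
    · have := (Complex.abs_re_le_norm (z - 2)).trans_lt hz
      simp only [Complex.sub_re, Complex.re_ofNat, abs_lt] at this
      linarith
    · have := norm_add_le (z - 2) 2
      simp only [sub_add_cancel, Complex.norm_ofNat] at this
      linarith
  have hd1 : DifferentiableOn ℂ (fun z => ∑' k, zetaTrapezoidError z k) U := by
    refine Complex.differentiableOn_tsum_of_summable_norm (u := fun k : ℕ =>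
      5 * 6 * 7 / 4 * (k + 1 : ℝ) ^ (-2 : ℝ))
      ((summable_add_one_rpow (by norm_num)).mul_left _)
      (fun k z hz => (differentiableAt_zetaTrapezoidError (hU1 z hz) k).differentiableWithinAt)
      hUo fun k z hz => ?_
    obtain ⟨hz1, hz2⟩ := hball z hz
    refine (norm_zetaTrapezoidError_le (hU1 z hz) (by linarith) k).trans ?_
    rw [norm_mul, norm_mul]
    have a1 : ‖z + 1‖ ≤ 6 := (norm_add_le _ _).trans (by rw [norm_one]; linarith)
    have a2 : ‖z + 2‖ ≤ 7 := (norm_add_le _ _).trans (by rw [Complex.norm_ofNat]; linarith)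
    gcongr
    · linarith [Nat.cast_nonneg (α := ℝ) k]
    · linarith
  have hd2 : DifferentiableOn ℂ
      (fun z => riemannZeta z - 1 / 2 + 1 / (1 - z) - z / 12) U := by
    intro z hz
    have := differentiableAt_riemannZeta (hU1 z hz)
    have h0 : 1 - z ≠ 0 := sub_ne_zero.mpr (hU1 z hz).symm
    refine DifferentiableAt.differentiableWithinAt ?_
    fun_prop (disch := assumption)
  have hz₀ : (2 + 2 * Complex.I) ∈ U := by
    refine ⟨?_, by norm_num⟩
    rw [Metric.mem_ball, dist_eq_norm]
    norm_num
  refine (hd1.analyticOnNhd hUo).eqOn_of_preconnected_of_eventuallyEq (hd2.analyticOnNhd hUo)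
    hUc.isPreconnected hz₀ ?_ ⟨?_, by simpa using h₂⟩
  · filter_upwards [(isOpen_lt continuous_const Complex.continuous_re).mem_nhds
      (show (1 : ℝ) < (2 + 2 * Complex.I).re by norm_num)] with z hz
    exact tsum_zetaTrapezoidError_of_one_lt_re hz
  · rw [Metric.mem_ball, dist_eq_norm, show (σ : ℂ) - 2 = ((σ - 2 : ℝ) : ℂ) by push_cast; ring,
      Complex.norm_real, Real.norm_eq_abs, abs_lt]
    constructor <;> linarith

theorem exists_abs_sum_rpow_sub_zeta_le {σ δ : ℝ} (h₁ : -1 < σ) (h₂ : σ ≠ 1) (hδ : 0 < δ)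
    (hδσ : δ ≤ σ + 2) :
    ∃ C, 0 ≤ C ∧ ∀ n : ℕ, 1 ≤ n →
      |∑ k ∈ Finset.Icc 1 (n - 1), (k : ℝ) ^ (-σ) - zr σ - (n : ℝ) ^ (1 - σ) / (1 - σ)
        + (n : ℝ) ^ (-σ) / 2 + σ / 12 * (n : ℝ) ^ (-σ - 1)| ≤ C * (n : ℝ) ^ (-σ - 2 + δ) := by
  have hσ : (σ : ℂ) ≠ 1 := by exact_mod_cast h₂
  set B : ℝ := ‖(σ : ℂ) * (σ + 1) * (σ + 2)‖ / 4 with hB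
  have hB0 : 0 ≤ B := by positivity
  have hZ := summable_add_one_rpow (p := -1 - δ) (by linarith)
  refine ⟨B * ∑' k : ℕ, (k + 1 : ℝ) ^ (-1 - δ),
    mul_nonneg hB0 (tsum_nonneg fun k => by positivity), fun n hn => ?_⟩
  obtain ⟨N, rfl⟩ : ∃ N, n = N + 1 := ⟨n - 1, by omega⟩
  have hsum := summable_zetaTrapezoidError hσ (by simp; linarith)
  have hsplit := hsum.sum_add_tsum_nat_add N
  rw [tsum_zetaTrapezoidError h₁ h₂, sum_zetaTrapezoidError] at hsplit
  have htail : ‖∑' k, zetaTrapezoidError σ (k + N)‖ ≤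
      B * (∑' k : ℕ, (k + 1 : ℝ) ^ (-1 - δ)) * (N + 1 : ℝ) ^ (-σ - 2 + δ) := by
    rw [mul_right_comm, ← tsum_mul_left]
    refine tsum_of_norm_bounded (hZ.mul_left _).hasSum fun k => ?_
    refine (norm_zetaTrapezoidError_le hσ (by simp; linarith) _).trans ?_
    rw [← hB, mul_assoc]
    refine mul_le_mul_of_nonneg_left ?_ hB0
    push_cast
    have hpos : (0 : ℝ) < k + N + 1 := by positivity
    rw [Complex.ofReal_re, show -σ - 3 = (-σ - 2 + δ) + (-1 - δ) by ring, Real.rpow_add hpos]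
    refine mul_le_mul ?_ ?_ (by positivity) (by positivity)
    · exact Real.rpow_le_rpow_of_nonpos (by positivity)
        (by linarith [Nat.cast_nonneg (α := ℝ) k]) (by linarith)
    · exact Real.rpow_le_rpow_of_nonpos (by positivity)
        (by linarith [Nat.cast_nonneg (α := ℝ) N]) (by linarith)
  push_cast
  refine le_trans ?_ htail
  rw [← abs_neg]
  refine le_trans (le_of_eq ?_) (Complex.abs_re_le_norm _)
  congr 1
  rw [← eq_sub_iff_add_eq'] at hsplit
  rw [hsplit]
  have hcast : ∀ (m : ℕ) (r : ℝ), ((m + 1 : ℝ) : ℂ) ^ (r : ℂ) = (((m + 1 : ℝ) ^ r : ℝ) : ℂ) :=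
    fun m r => (Complex.ofReal_cpow (by positivity) r).symm
  have e1 : (-σ : ℂ) = ((-σ : ℝ) : ℂ) := by push_cast; rfl
  have e2 : (1 - σ : ℂ) = ((1 - σ : ℝ) : ℂ) := by push_cast; rfl
  have e3 : ((-σ : ℝ) - 1 : ℂ) = ((-σ - 1 : ℝ) : ℂ) := by push_cast; rfl
  rw [e2, e1, e3]
  simp only [hcast]
  have key : ∀ z : ℂ, ∀ S a b c d : ℝ, (z - 1 / 2 + 1 / (d : ℂ) - σ / 12 -
      ((S : ℂ) - 1 / 2 + (a : ℂ) / 2 - ((b : ℂ) - 1) / d + σ / 12 * ((c : ℂ) - 1))).re =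
      -(S - z.re - b / d + a / 2 + σ / 12 * c) := by
    intro z S a b c d
    have : z - 1 / 2 + 1 / (d : ℂ) - σ / 12 -
      ((S : ℂ) - 1 / 2 + (a : ℂ) / 2 - ((b : ℂ) - 1) / d + σ / 12 * ((c : ℂ) - 1)) =
      z + ((-(S - b / d + a / 2 + σ / 12 * c) : ℝ) : ℂ) := by
      push_cast; ring
    rw [this, Complex.add_re, Complex.ofReal_re]
    ring
  rw [← Complex.ofReal_sum, key, zr]
  have : ∑ k ∈ Finset.Icc 1 N, (k : ℝ) ^ (-σ) = ∑ k ∈ Finset.range N, (k + 1 : ℝ) ^ (-σ) := by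
    rw [← Finset.Ico_add_one_right_eq_Icc, Finset.sum_Ico_eq_sum_range]
    simp [add_comm]
  rw [this]

theorem exists_abs_scaled_sum_rpow_sub_le {σ δ x : ℝ} (h₁ : -1 < σ) (h₂ : σ ≠ 1) (hδ : 0 < δ)
    (hδσ : δ ≤ σ + 2) (hx : 0 < x) :
    ∃ C, 0 ≤ C ∧ ∀ n : ℕ, 1 ≤ n →
      |(x / n) ^ (1 - σ) * (∑ k ∈ Finset.Icc 1 (n - 1), (k : ℝ) ^ (-σ) - zr σ)
        - (x ^ (1 - σ) / (1 - σ) - (x / n) * x ^ (-σ) / 2 - (x / n) ^ 2 * σ / 12 * x ^ (-σ - 1))|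
      ≤ C * (x / n) ^ (3 - δ) := by
  obtain ⟨C, hC, h⟩ := exists_abs_sum_rpow_sub_zeta_le h₁ h₂ hδ hδσ
  refine ⟨C * x ^ (-σ - 2 + δ), by positivity, fun n hn => ?_⟩
  have hn0 : (0 : ℝ) < n := by exact_mod_cast hn
  have hh : 0 < x / n := by positivity
  have hnx : (n : ℝ) = x / (x / n) := by field_simp
  have hpow : ∀ p : ℝ, (n : ℝ) ^ p = x ^ p * (x / n) ^ (-p) := fun p => by
    nth_rewrite 1 [hnx]
    rw [Real.div_rpow hx.le hh.le, Real.rpow_neg hh.le, div_eq_mul_inv]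
  have hmul : ∀ p : ℝ, (x / n) ^ (1 - σ) * (n : ℝ) ^ p = x ^ p * (x / n) ^ (1 - σ - p) :=
    fun p => by
      rw [hpow, mul_left_comm, ← Real.rpow_add hh, ← sub_eq_add_neg]
  have e1 : (x / n) ^ (1 - σ) * (n : ℝ) ^ (1 - σ) = x ^ (1 - σ) := by
    rw [hmul, sub_self, Real.rpow_zero, mul_one]
  have e2 : (x / n) ^ (1 - σ) * (n : ℝ) ^ (-σ) = x ^ (-σ) * (x / n) := by
    rw [hmul, show 1 - σ - -σ = 1 by ring, Real.rpow_one]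
  have e3 : (x / n) ^ (1 - σ) * (n : ℝ) ^ (-σ - 1) = x ^ (-σ - 1) * (x / n) ^ 2 := by
    rw [hmul, show 1 - σ - (-σ - 1) = (2 : ℕ) by push_cast; ring, Real.rpow_natCast]
  have e4 : (x / n) ^ (1 - σ) * (n : ℝ) ^ (-σ - 2 + δ) = x ^ (-σ - 2 + δ) * (x / n) ^ (3 - δ) := by
    rw [hmul, show 1 - σ - (-σ - 2 + δ) = 3 - δ by ring]
  have := mul_le_mul_of_nonneg_left (h n hn) (Real.rpow_nonneg hh.le (1 - σ))
  rw [← abs_of_nonneg (Real.rpow_nonneg hh.le (1 - σ)), ← abs_mul,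
    abs_of_nonneg (Real.rpow_nonneg hh.le (1 - σ))] at this
  refine (le_of_eq ?_).trans (this.trans_eq ?_)
  · congr 1
    linear_combination e1 / (1 - σ) - e2 / 2 - σ / 12 * e3
  · linear_combination C * e4

theorem abs_le_pow_succ_of_hasDerivAt {r r' : ℝ → ℝ} {x M : ℝ} {m : ℕ} (hM : 0 ≤ M)
    (hr : ∀ t, HasDerivAt r (r' t) t) (hr0 : r 0 = 0)
    (hb : ∀ t ∈ Set.Icc 0 x, |r' t| ≤ M * t ^ m) :
    ∀ t ∈ Set.Icc 0 x, |r t| ≤ M * t ^ (m + 1) := by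
  intro t ht
  have := (convex_Icc 0 t).norm_image_sub_le_of_norm_hasDerivWithin_le (C := M * t ^ m)
    (fun u _ => (hr u).hasDerivWithinAt) (fun u hu => ?_)
    (Set.left_mem_Icc.mpr ht.1) (Set.right_mem_Icc.mpr ht.1)
  · rw [hr0, sub_zero, sub_zero, Real.norm_of_nonneg ht.1, Real.norm_eq_abs] at this
    exact this.trans_eq (by ring)
  · refine (hb u ⟨hu.1, hu.2.trans ht.2⟩).trans ?_
    have := hu.1
    gcongr
    exact hu.2

theorem sum_range_correctedTrapezoid (G P D : ℕ → ℝ) (h : ℝ) (N : ℕ) :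
    ∑ k ∈ Finset.range N, ((h / 2) * (G k + G (k + 1)) - (P (k + 1) - P k)
      - (h ^ 2 / 12) * (D (k + 1) - D k)) =
    h * ∑ k ∈ Finset.range N, G k - h / 2 * G 0 + h / 2 * G N - (P N - P 0)
      - h ^ 2 / 12 * (D N - D 0) := by
  induction N with
  | zero => simp
  | succ N ih => rw [Finset.sum_range_succ, ih, Finset.sum_range_succ]; ring

theorem intervalIntegrable_mul_rpow_neg {α : ℝ} (hα : α < 1) {f : ℝ → ℝ} (hf : Continuous f)
    (a b : ℝ) : IntervalIntegrable (fun τ => f τ * τ ^ (-α)) MeasureTheory.volume a b :=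
  (intervalIntegral.intervalIntegrable_rpow' (by linarith)).continuousOn_mul hf.continuousOn

theorem hasDerivAt_integral_mul_rpow_neg {α : ℝ} (hα : α < 1) {f : ℝ → ℝ} (hf : Continuous f)
    {t : ℝ} (ht : 0 < t) :
    HasDerivAt (fun u => ∫ τ in (0 : ℝ)..u, f τ * τ ^ (-α)) (f t * t ^ (-α)) t := by
  refine intervalIntegral.integral_hasDerivAt_right (intervalIntegrable_mul_rpow_neg hα hf 0 t)
    (Measurable.stronglyMeasurable (by fun_prop)).stronglyMeasurableAtFilter ?_
  exact hf.continuousAt.mul (Real.continuousAt_rpow_const _ _ (Or.inl ht.ne'))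

theorem pow_mul_rpow_of_add_eq {t p q : ℝ} {m : ℕ} (ht : 0 < t) (h : p + m = q) :
    t ^ m * t ^ p = t ^ q := by
  rw [← h, Real.rpow_add ht, Real.rpow_natCast, mul_comm]

theorem abs_scaled_sum_sub_le {β x K h : ℝ} {N : ℕ} (hβ : β < -1) (hK : 0 ≤ K)
    {Φ g g₁ g₂ g₃ : ℝ → ℝ} (dΦ : ∀ t, 0 < t → HasDerivAt Φ (g t) t)
    (dg : ∀ t, 0 < t → HasDerivAt g (g₁ t) t) (dg₁ : ∀ t, 0 < t → HasDerivAt g₁ (g₂ t) t)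
    (dg₂ : ∀ t, 0 < t → HasDerivAt g₂ (g₃ t) t)
    (hg₃ : ∀ t ∈ Set.Ioc 0 x, |g₃ t| ≤ K * t ^ β) (hh : 0 < h) (hNh : (N + 1 : ℝ) * h = x) :
    |h * ∑ k ∈ Finset.range N, g ((k + 1) * h) - h / 2 * g h + h / 2 * g x - (Φ x - Φ h)
      - h ^ 2 / 12 * (g₁ x - g₁ h)| ≤
      K / 4 * (∑' k : ℕ, (k + 1 : ℝ) ^ β) * h ^ (4 + β) := by
  have step : ∀ k ∈ Finset.range N, |(h / 2) * (g ((k + 1) * h) + g (((k + 1 : ℕ) + 1) * h))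
      - (Φ (((k + 1 : ℕ) + 1) * h) - Φ ((k + 1) * h))
      - (h ^ 2 / 12) * (g₁ (((k + 1 : ℕ) + 1) * h) - g₁ ((k + 1) * h))|
      ≤ K / 4 * h ^ (4 + β) * (k + 1 : ℝ) ^ β := by
    intro k hk
    have hkN : (k : ℝ) + 1 ≤ N := by exact_mod_cast Finset.mem_range.mp hk
    have hpos : 0 < (k + 1 : ℝ) * h := by positivity
    have hlt : ∀ t ∈ Set.Icc ((k + 1 : ℝ) * h) ((k + 1) * h + h), t ∈ Set.Ioc 0 x := fun t ht =>
      ⟨hpos.trans_le ht.1, ht.2.trans (by nlinarith)⟩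
    have := norm_correctedTrapezoid_sub_le hh.le (fun t ht => dΦ t (hlt t ht).1)
      (fun t ht => dg t (hlt t ht).1) (fun t ht => dg₁ t (hlt t ht).1)
      (fun t ht => dg₂ t (hlt t ht).1) (M := K * ((k + 1) * h) ^ β) (fun t ht => by
        refine (hg₃ t (hlt t ht)).trans (mul_le_mul_of_nonneg_left ?_ hK)
        exact Real.rpow_le_rpow_of_nonpos hpos ht.1 (by linarith))
    push_cast
    rw [show ((k : ℝ) + 1 + 1) * h = (k + 1) * h + h by ring]
    refine this.trans_eq ?_
    rw [Real.mul_rpow (by positivity) hh.le,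
      ← pow_mul_rpow_of_add_eq (p := β) (q := 4 + β) (m := 4) hh (by push_cast; ring)]
    ring
  have tot := (Finset.abs_sum_le_sum_abs _ _).trans (Finset.sum_le_sum step)
  rw [sum_range_correctedTrapezoid (fun k => g ((k + 1) * h)) (fun k => Φ ((k + 1) * h))
    (fun k => g₁ ((k + 1) * h)), ← Finset.mul_sum] at tot
  have hZN : ∑ k ∈ Finset.range N, (k + 1 : ℝ) ^ β ≤ ∑' k : ℕ, (k + 1 : ℝ) ^ β :=
    (summable_add_one_rpow hβ).sum_le_tsum _ fun k _ => by positivity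
  have tot' := tot.trans (mul_le_mul_of_nonneg_left hZN (by positivity))
  simp only [Nat.cast_zero, zero_add, one_mul, hNh] at tot'
  exact tot'.trans_eq (by ring)

theorem abs_leibniz_three_mul_rpow_le {β t M a₀ a₁ a₂ a₃ : ℝ} (ht : 0 < t)
    (h₀ : |a₀| ≤ M * t ^ 3) (h₁ : |a₁| ≤ M * t ^ 2) (h₂ : |a₂| ≤ M * t) (h₃ : |a₃| ≤ M) :
    |a₃ * t ^ β + 3 * β * a₂ * t ^ (β - 1) + 3 * (β * (β - 1)) * a₁ * t ^ (β - 2)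
      + β * (β - 1) * (β - 2) * a₀ * t ^ (β - 3)| ≤
      M * (1 + |3 * β| + |3 * (β * (β - 1))| + |β * (β - 1) * (β - 2)|) * t ^ β := by
  have ab : ∀ (c ρ p : ℝ) (m : ℕ), |ρ| ≤ M * t ^ m → p + m = β →
      |c * ρ * t ^ p| ≤ |c| * M * t ^ β := by
    intro c ρ p m hρ hp
    rw [abs_mul, abs_mul, abs_of_pos (Real.rpow_pos_of_pos ht p), ← pow_mul_rpow_of_add_eq ht hp]
    calc |c| * |ρ| * t ^ p ≤ |c| * (M * t ^ m) * t ^ p := by gcongr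
      _ = _ := by ring
  have b₃ := ab 1 a₃ β 0 (by simpa using h₃) (by simp)
  have b₂ := ab (3 * β) a₂ (β - 1) 1 (by simpa using h₂) (by simp)
  have b₁ := ab (3 * (β * (β - 1))) a₁ (β - 2) 2 h₁ (by simp)
  have b₀ := ab (β * (β - 1) * (β - 2)) a₀ (β - 3) 3 h₀ (by simp)
  rw [one_mul, abs_one] at b₃
  refine (abs_add_le _ _).trans ?_
  have t₁ := abs_add_le (a₃ * t ^ β + 3 * β * a₂ * t ^ (β - 1))
    (3 * (β * (β - 1)) * a₁ * t ^ (β - 2))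
  have t₂ := abs_add_le (a₃ * t ^ β) (3 * β * a₂ * t ^ (β - 1))
  linarith

theorem abs_integral_mul_rpow_neg_le {α h M : ℝ} (hα1 : α < 1) (hh : 0 < h) (hM : 0 ≤ M)
    {f : ℝ → ℝ} (hf : ∀ t, 0 ≤ t → t ≤ h → |f t| ≤ M * t ^ 2) :
    |∫ τ in (0 : ℝ)..h, f τ * τ ^ (-α)| ≤ M * h ^ (3 - α) := by
  have key : ‖∫ τ in (0 : ℝ)..h, f τ * τ ^ (-α)‖ ≤ M * h ^ (2 - α) * |h - 0| := by
    refine intervalIntegral.norm_integral_le_of_norm_le_const fun τ hτ => ?_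
    rw [Set.uIoc_of_le hh.le] at hτ
    rw [norm_mul, Real.norm_eq_abs, Real.norm_of_nonneg (Real.rpow_nonneg hτ.1.le _)]
    calc |f τ| * τ ^ (-α) ≤ M * τ ^ 2 * τ ^ (-α) :=
          mul_le_mul_of_nonneg_right (hf τ hτ.1.le hτ.2) (Real.rpow_nonneg hτ.1.le _)
      _ = M * τ ^ (2 - α) := by
        rw [mul_assoc, pow_mul_rpow_of_add_eq (q := 2 - α) hτ.1 (by push_cast; ring)]
      _ ≤ _ := mul_le_mul_of_nonneg_left
        (Real.rpow_le_rpow hτ.1.le hτ.2 (by linarith)) hM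
  rw [sub_zero, abs_of_pos hh] at key
  refine key.trans_eq ?_
  rw [← pow_mul_rpow_of_add_eq (p := 2 - α) (q := 3 - α) (m := 1) hh (by push_cast; ring)]
  ring

theorem exists_abs_scaled_sum_remainder_le {α x M : ℝ} (hα0 : 0 < α) (hα1 : α < 1) (hx : 0 < x)
    {r r₁ r₂ r₃ : ℝ → ℝ} (hr : ∀ t, HasDerivAt r (r₁ t) t) (hr₁ : ∀ t, HasDerivAt r₁ (r₂ t) t)
    (hr₂ : ∀ t, HasDerivAt r₂ (r₃ t) t) (h0 : r 0 = 0) (h1 : r₁ 0 = 0) (h2 : r₂ 0 = 0)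
    (hM : ∀ t ∈ Set.Icc 0 x, |r₃ t| ≤ M) :
    ∃ C, 0 ≤ C ∧ ∀ n : ℕ, 1 ≤ n →
      |x / n * ∑ k ∈ Finset.Icc 1 (n - 1), r (k * (x / n)) * (k * (x / n)) ^ (-1 - α)
        - 1 / α * ((∫ τ in (0 : ℝ)..x, r₁ τ * τ ^ (-α)) - r x * x ^ (-α))
        + x / n / 2 * (r x * x ^ (-1 - α))
        - (x / n) ^ 2 / 12 * (r₁ x * x ^ (-1 - α) + (-1 - α) * r x * x ^ (-2 - α))|
      ≤ C * (x / n) ^ (3 - α) := by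
  have hM0 : 0 ≤ M := (abs_nonneg _).trans (hM 0 ⟨le_rfl, hx.le⟩)
  have b2 := abs_le_pow_succ_of_hasDerivAt (m := 0) hM0 hr₂ h2 (by simpa using hM)
  have b1 := abs_le_pow_succ_of_hasDerivAt hM0 hr₁ h1 b2
  have b0 := abs_le_pow_succ_of_hasDerivAt hM0 hr h0 b1
  norm_num at b2 b1 b0
  have hr₁c : Continuous r₁ := continuous_iff_continuousAt.mpr fun t => (hr₁ t).continuousAt
  obtain ⟨β, hβ⟩ : ∃ β, β = -1 - α := ⟨_, rfl⟩
  have pw : ∀ (p : ℝ) {t : ℝ}, 0 < t → HasDerivAt (fun u : ℝ => u ^ p) (p * t ^ (p - 1)) t :=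
    fun p t ht => Real.hasDerivAt_rpow_const (Or.inl ht.ne')
  obtain ⟨Φ, hΦ⟩ : ∃ Φ : ℝ → ℝ, Φ = fun t =>
    1 / α * ((∫ τ in (0 : ℝ)..t, r₁ τ * τ ^ (-α)) - r t * t ^ (-α)) := ⟨_, rfl⟩
  have dΦ : ∀ t, 0 < t → HasDerivAt Φ (r t * t ^ β) t := fun t ht => by
    rw [hΦ]
    convert! ((hasDerivAt_integral_mul_rpow_neg hα1 hr₁c ht).sub
      ((hr t).mul (pw (-α) ht))).const_mul (1 / α) using 1
    rw [hβ, show -α - 1 = -1 - α by ring]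
    field_simp
    ring
  have dg : ∀ t, 0 < t → HasDerivAt (fun t => r t * t ^ β)
      (r₁ t * t ^ β + β * r t * t ^ (β - 1)) t := fun t ht => by
    convert! (hr t).mul (pw β ht) using 1
    ring
  have dg₁ : ∀ t, 0 < t → HasDerivAt (fun t => r₁ t * t ^ β + β * r t * t ^ (β - 1))
      (r₂ t * t ^ β + 2 * β * r₁ t * t ^ (β - 1) + β * (β - 1) * r t * t ^ (β - 2)) t :=
    fun t ht => by
    convert! ((hr₁ t).mul (pw β ht)).add (((hr t).const_mul β).mul (pw (β - 1) ht)) using 1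
    rw [show β - 1 - 1 = β - 2 by ring]; ring
  have dg₂ : ∀ t, 0 < t → HasDerivAt
      (fun t => r₂ t * t ^ β + 2 * β * r₁ t * t ^ (β - 1) + β * (β - 1) * r t * t ^ (β - 2))
      (r₃ t * t ^ β + 3 * β * r₂ t * t ^ (β - 1) + 3 * (β * (β - 1)) * r₁ t * t ^ (β - 2)
        + β * (β - 1) * (β - 2) * r t * t ^ (β - 3)) t := fun t ht => by
    convert! (((hr₂ t).mul (pw β ht)).add (((hr₁ t).const_mul (2 * β)).mul (pw (β - 1) ht))).add
      (((hr t).const_mul (β * (β - 1))).mul (pw (β - 2) ht)) using 1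
    rw [show β - 1 - 1 = β - 2 by ring, show β - 2 - 1 = β - 3 by ring]; ring
  obtain ⟨K, hK⟩ : ∃ K, K = M * (1 + |3 * β| + |3 * (β * (β - 1))| + |β * (β - 1) * (β - 2)|) :=
    ⟨_, rfl⟩
  have hK0 : 0 ≤ K := by rw [hK]; positivity
  have bg : ∀ h, 0 < h → h ≤ x → |h / 2 * (r h * h ^ β)| ≤ M / 2 * h ^ (3 - α) := by
    intro h hh hhx
    have := b0 h hh.le hhx
    rw [abs_mul, abs_mul, abs_of_pos (half_pos hh), abs_of_pos (Real.rpow_pos_of_pos hh β),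
      ← pow_mul_rpow_of_add_eq (p := β) (q := 3 - α) (m := 4) hh (by rw [hβ]; push_cast; ring)]
    calc h / 2 * (|r h| * h ^ β) ≤ h / 2 * ((M * h ^ 3) * h ^ β) := by gcongr
      _ = _ := by ring
  have bg₁ : ∀ h, 0 < h → h ≤ x → |h ^ 2 / 12 * (r₁ h * h ^ β + β * r h * h ^ (β - 1))| ≤
      M * (1 + |β|) / 12 * h ^ (3 - α) := by
    intro h hh hhx
    have c0 := b0 h hh.le hhx
    have c1 := b1 h hh.le hhx
    rw [abs_mul, abs_of_pos (by positivity : 0 < h ^ 2 / 12)]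
    have : |r₁ h * h ^ β + β * r h * h ^ (β - 1)| ≤ M * (1 + |β|) * (h ^ 2 * h ^ β) := by
      refine (abs_add_le _ _).trans ?_
      rw [abs_mul, abs_mul, abs_mul, abs_of_pos (Real.rpow_pos_of_pos hh β),
        abs_of_pos (Real.rpow_pos_of_pos hh (β - 1))]
      calc |r₁ h| * h ^ β + |β| * |r h| * h ^ (β - 1)
          ≤ (M * h ^ 2) * h ^ β + |β| * (M * h ^ 3) * h ^ (β - 1) := by gcongr
        _ = _ := by
          rw [← pow_mul_rpow_of_add_eq (p := β - 1) (q := β) (m := 1) hh (by simp)]; ring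
    rw [← pow_mul_rpow_of_add_eq (p := β) (q := 3 - α) (m := 4) hh (by rw [hβ]; push_cast; ring)]
    calc _ ≤ h ^ 2 / 12 * (M * (1 + |β|) * (h ^ 2 * h ^ β)) := by gcongr
      _ = _ := by ring
  have bΦ : ∀ h, 0 < h → h ≤ x → |Φ h| ≤ 1 / α * (2 * M) * h ^ (3 - α) := by
    intro h hh hhx
    have i1 := abs_integral_mul_rpow_neg_le hα1 hh hM0 fun t ht hth => b1 t ht (hth.trans hhx)
    have i2 : |r h * h ^ (-α)| ≤ M * h ^ (3 - α) := by
      rw [abs_mul, abs_of_pos (Real.rpow_pos_of_pos hh (-α)),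
        ← pow_mul_rpow_of_add_eq (p := -α) (q := 3 - α) (m := 3) hh (by push_cast; ring), ← mul_assoc]
      have := b0 h hh.le hhx
      gcongr
    rw [hΦ, abs_mul, abs_of_pos (by positivity : 0 < 1 / α), mul_assoc]
    refine mul_le_mul_of_nonneg_left ?_ (by positivity)
    have := abs_sub (∫ τ in (0 : ℝ)..h, r₁ τ * τ ^ (-α)) (r h * h ^ (-α))
    linarith
  refine ⟨K / 4 * (∑' k : ℕ, (k + 1 : ℝ) ^ β) + M / 2 + 1 / α * (2 * M) + M * (1 + |β|) / 12,
    ?_, fun n hn => ?_⟩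
  · have : 0 ≤ ∑' k : ℕ, (k + 1 : ℝ) ^ β := tsum_nonneg fun k => by positivity
    positivity
  obtain ⟨N, rfl⟩ : ∃ N, n = N + 1 := ⟨n - 1, by omega⟩
  rw [Nat.add_sub_cancel]
  obtain ⟨h, hh_def⟩ : ∃ h, h = x / (N + 1 : ℕ) := ⟨_, rfl⟩
  have hh : 0 < h := by rw [hh_def]; positivity
  have hNh : (N + 1 : ℝ) * h = x := by rw [hh_def]; push_cast; field_simp
  have hhx : h ≤ x := by
    rw [← hNh]
    nlinarith [Nat.cast_nonneg (α := ℝ) N]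
  have main := abs_scaled_sum_sub_le (β := β) (by linarith) hK0 dΦ dg dg₁ dg₂
    (fun t ht => (abs_leibniz_three_mul_rpow_le ht.1 (b0 t ht.1.le ht.2) (b1 t ht.1.le ht.2)
      (b2 t ht.1.le ht.2) (hM t ⟨ht.1.le, ht.2⟩)).trans_eq (by rw [hK])) hh hNh
  have hsum : ∑ k ∈ Finset.Icc 1 N, r (k * h) * (k * h) ^ β =
      ∑ k ∈ Finset.range N, r ((k + 1) * h) * ((k + 1) * h) ^ β := by
    rw [← Finset.Ico_add_one_right_eq_Icc, Finset.sum_Ico_eq_sum_range]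
    simp [add_comm]
  rw [← hh_def, ← hβ, hsum, show -2 - α = β - 1 by rw [hβ]; ring,
    ← show Φ x = 1 / α * ((∫ τ in (0 : ℝ)..x, r₁ τ * τ ^ (-α)) - r x * x ^ (-α)) by rw [hΦ]]
  rw [show 4 + β = 3 - α by rw [hβ]; ring] at main
  have u0 := abs_le.mp main
  have u1 := abs_le.mp (bg h hh hhx)
  have u2 := abs_le.mp (bg₁ h hh hhx)
  have u3 := abs_le.mp (bΦ h hh hhx)
  rw [abs_le]
  constructor <;> linarith

theorem caputo_eq_integral_mul_rpow_neg {α x : ℝ} (hα0 : 0 < α) (hx : 0 < x) (y : ℝ → ℝ) :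
    caputo α y x = 1 / Real.Gamma (-α) *
      (-(1 / α) * ∫ τ in (0 : ℝ)..x, deriv y (x - τ) * τ ^ (-α)) := by
  have hΓ : Real.Gamma (1 - α) = -α * Real.Gamma (-α) := by
    rw [← Real.Gamma_add_one (neg_ne_zero.mpr hα0.ne')]
    ring_nf
  have hI := intervalIntegral.integral_comp_sub_left (a := 0) (b := x)
    (fun t => deriv y t / (x - t) ^ α) x
  rw [sub_self, sub_zero] at hI
  rw [caputo, ← hI, hΓ, intervalIntegral.integral_congr (g := fun τ => deriv y (x - τ) * τ ^ (-α))]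
  · rw [one_div_mul_eq_div, one_div_mul_eq_div, neg_mul, neg_mul, div_neg, neg_div,
      one_div_mul_eq_div, div_div]
  · intro τ hτ
    rw [Set.uIcc_of_le hx.le] at hτ
    simp only [sub_sub_cancel]
    rw [Real.rpow_neg hτ.1, div_eq_mul_inv]

theorem integral_sub_linear_mul_rpow_neg {α x : ℝ} (hα1 : α < 1) (hx : 0 < x) {f : ℝ → ℝ}
    (hf : Continuous f) (a b : ℝ) :
    ∫ τ in (0 : ℝ)..x, (-f τ - a - b * τ) * τ ^ (-α) =
      -(∫ τ in (0 : ℝ)..x, f τ * τ ^ (-α)) - a * (x * x ^ (-α) / (1 - α))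
        - b * (x ^ 2 * x ^ (-α) / (2 - α)) := by
  have i₀ := intervalIntegrable_mul_rpow_neg hα1 hf 0 x
  have i₀' : IntervalIntegrable (fun τ => -(f τ * τ ^ (-α))) MeasureTheory.volume 0 x := i₀.neg
  have i₁ := intervalIntegral.intervalIntegrable_rpow' (a := 0) (b := x) (by linarith : -1 < -α)
  have i₂ := intervalIntegral.intervalIntegrable_rpow' (a := 0) (b := x) (by linarith : -1 < 1 - α)
  have hI : ∫ τ in (0 : ℝ)..x, (-f τ - a - b * τ) * τ ^ (-α) =
      ∫ τ in (0 : ℝ)..x, (-(f τ * τ ^ (-α)) - a * τ ^ (-α) - b * τ ^ (1 - α)) := by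
    refine intervalIntegral.integral_congr_ae (MeasureTheory.ae_of_all _ fun τ hτ => ?_)
    rw [Set.uIoc_of_le hx.le] at hτ
    rw [← pow_mul_rpow_of_add_eq (p := -α) (q := 1 - α) (m := 1) hτ.1 (by push_cast; ring)]
    ring
  rw [hI, intervalIntegral.integral_sub (i₀'.sub (i₁.const_mul a)) (i₂.const_mul b),
    intervalIntegral.integral_sub i₀' (i₁.const_mul a), intervalIntegral.integral_neg,
    intervalIntegral.integral_const_mul, intervalIntegral.integral_const_mul,
    integral_rpow (Or.inl (by linarith)), integral_rpow (Or.inl (by linarith)),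
    Real.zero_rpow (by linarith), Real.zero_rpow (by linarith),
    pow_mul_rpow_of_add_eq (p := -α) (q := 1 - α + 1) (m := 2) hx (by push_cast; ring),
    ← pow_mul_rpow_of_add_eq (p := -α) (q := -α + 1) (m := 1) hx (by push_cast; ring),
    show -α + 1 = 1 - α by ring, show 1 - α + 1 = 2 - α by ring]
  ring

theorem expansion_power_neg_one_sub_alpha
    (α x : ℝ) (hα0 : 0 < α) (hα1 : α < 1) (hx : 0 < x)
    (y : ℝ → ℝ) (hy : ContDiff ℝ (⊤ : ℕ∞) y)
    (hy0 : y 0 = 0) (hy'0 : deriv y 0 = 0) (hy''0 : iteratedDeriv 2 y 0 = 0) :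
    ∃ C > 0, ∀ n : ℕ, 2 ≤ n →
      |(1 / (Real.Gamma (-α) * (x / n) ^ α)) *
          ((∑ k ∈ Finset.Icc 1 (n - 1), y (x - (k:ℝ) * (x / n)) / (k:ℝ) ^ (1 + α))
            - zr (1 + α) * y x)
        - caputo α y x
        + (zr α / Real.Gamma (-α)) * deriv y x * (x / n) ^ (1 - α)
        - (zr (α - 1) / (2 * Real.Gamma (-α))) * iteratedDeriv 2 y x * (x / n) ^ (2 - α)|
      ≤ C * (x / n) ^ (3 - α) := by
  have hd : ∀ (m : ℕ) t, HasDerivAt (iteratedDeriv m y) (iteratedDeriv (m + 1) y t) t :=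
    fun m t => by
      rw [iteratedDeriv_succ]
      exact ((hy.differentiable_iteratedDeriv m (by exact_mod_cast WithTop.coe_lt_top _)) t).hasDerivAt
  have hc : ∀ m : ℕ, Continuous (iteratedDeriv m y) :=
    fun m => continuous_iff_continuousAt.mpr fun t => (hd m t).continuousAt
  have hs : ∀ (m : ℕ) t, HasDerivAt (fun u => iteratedDeriv m y (x - u))
      (-iteratedDeriv (m + 1) y (x - t)) t := fun m t => (hd m (x - t)).comp_const_sub x t
  obtain ⟨M, hM⟩ := isCompact_Icc.exists_bound_of_continuousOn (s := Set.Icc 0 x)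
    (f := fun t => -iteratedDeriv 3 y (x - t))
    (((hc 3).comp (continuous_const.sub continuous_id)).neg.continuousOn)
  obtain ⟨f₀, hf₀⟩ : ∃ c, c = y x := ⟨_, rfl⟩
  obtain ⟨f₁, hf₁⟩ : ∃ c, c = -deriv y x := ⟨_, rfl⟩
  obtain ⟨f₂, hf₂⟩ : ∃ c, c = iteratedDeriv 2 y x := ⟨_, rfl⟩
  obtain ⟨r, hr⟩ : ∃ r : ℝ → ℝ, r = fun t => y (x - t) - f₀ - f₁ * t - f₂ / 2 * t ^ 2 :=
    ⟨_, rfl⟩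
  obtain ⟨r₁, hr₁⟩ : ∃ r₁ : ℝ → ℝ, r₁ = fun t => -deriv y (x - t) - f₁ - f₂ * t := ⟨_, rfl⟩
  have dr : ∀ t, HasDerivAt r (r₁ t) t := fun t => by
    have := hs 0 t
    simp only [iteratedDeriv_zero, zero_add, iteratedDeriv_one] at this
    rw [hr, hr₁]
    convert! ((this.sub_const f₀).sub ((hasDerivAt_id t).const_mul f₁)).sub
      ((hasDerivAt_pow 2 t).const_mul (f₂ / 2)) using 1
    ring
  have dr₁ : ∀ t, HasDerivAt r₁ (iteratedDeriv 2 y (x - t) - f₂) t := fun t => by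
    have := hs 1 t
    simp only [iteratedDeriv_one, Nat.reduceAdd] at this
    rw [hr₁]
    convert! ((this.neg).sub_const f₁).sub ((hasDerivAt_id t).const_mul f₂) using 1
    ring
  obtain ⟨C, hC, hR⟩ := exists_abs_scaled_sum_remainder_le hα0 hα1 hx dr dr₁
    (fun t => (hs 2 t).sub_const f₂) (by simp [hr, hf₀]) (by simp [hr₁, hf₁]) (by simp [hf₂]) hM
  obtain ⟨C₀, hC₀, hQ₀⟩ := exists_abs_scaled_sum_rpow_sub_le (σ := 1 + α) (by linarith)
    (by linarith) hα0 (by linarith) hx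
  obtain ⟨C₁, hC₁, hQ₁⟩ := exists_abs_scaled_sum_rpow_sub_le (σ := α) (by linarith)
    (by linarith) hα0 (by linarith) hx
  obtain ⟨C₂, hC₂, hQ₂⟩ := exists_abs_scaled_sum_rpow_sub_le (σ := α - 1) (by linarith)
    (by linarith) hα0 (by linarith) hx
  refine ⟨|1 / Real.Gamma (-α)| * (C + |f₀| * C₀ + |f₁| * C₁ + |f₂ / 2| * C₂) + 1,
    by positivity, fun n hn => ?_⟩
  specialize hR n (by omega)
  specialize hQ₀ n (by omega)
  specialize hQ₁ n (by omega)
  specialize hQ₂ n (by omega)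
  have hh : 0 < x / n := div_pos hx (by exact_mod_cast (by omega : 0 < n))
  obtain ⟨h, hh_def⟩ : ∃ h, h = x / n := ⟨_, rfl⟩
  rw [← hh_def] at hR hQ₀ hQ₁ hQ₂ hh ⊢
  have hsum : h ^ (-α) * ∑ k ∈ Finset.Icc 1 (n - 1), y (x - (k : ℝ) * h) / (k : ℝ) ^ (1 + α) =
      h * ∑ k ∈ Finset.Icc 1 (n - 1), r (k * h) * (k * h) ^ (-1 - α)
        + f₀ * (h ^ (-α) * ∑ k ∈ Finset.Icc 1 (n - 1), (k : ℝ) ^ (-(1 + α)))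
        + f₁ * (h ^ (1 - α) * ∑ k ∈ Finset.Icc 1 (n - 1), (k : ℝ) ^ (-α))
        + f₂ / 2 * (h ^ (2 - α) * ∑ k ∈ Finset.Icc 1 (n - 1), (k : ℝ) ^ (-(α - 1))) := by
    simp only [Finset.mul_sum, ← Finset.sum_add_distrib]
    refine Finset.sum_congr rfl fun k hk => ?_
    have hk : (0 : ℝ) < k := by exact_mod_cast (Finset.mem_Icc.mp hk).1
    rw [div_eq_mul_inv, ← Real.rpow_neg hk.le, Real.mul_rpow hk.le hh.le,
      show -(1 + α) = -1 - α by ring,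
      ← pow_mul_rpow_of_add_eq (p := -1 - α) (q := -α) (m := 1) hk (by push_cast; ring),
      ← pow_mul_rpow_of_add_eq (p := -1 - α) (q := -(α - 1)) (m := 2) hk (by push_cast; ring),
      ← pow_mul_rpow_of_add_eq (p := -1 - α) (q := -α) (m := 1) hh (by push_cast; ring),
      ← pow_mul_rpow_of_add_eq (p := -1 - α) (q := 1 - α) (m := 2) hh (by push_cast; ring),
      ← pow_mul_rpow_of_add_eq (p := -1 - α) (q := 2 - α) (m := 3) hh (by push_cast; ring), hr]
    ring
  have hI := integral_sub_linear_mul_rpow_neg hα1 hx (f := fun τ => deriv y (x - τ))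
    ((iteratedDeriv_one (f := y) ▸ hc 1).comp (continuous_const.sub continuous_id)) f₁ f₂
  have hrx : r x = -f₀ - f₁ * x - f₂ / 2 * x ^ 2 := by simp [hr, hy0]
  have hr₁x : r₁ x = -f₁ - f₂ * x := by simp [hr₁, hy'0]
  obtain ⟨X, hX⟩ : ∃ X, X = x ^ (-α) := ⟨_, rfl⟩
  have hX₁ : x ^ (-1 - α) = X / x := by
    rw [hX, ← Real.rpow_sub_one hx.ne']; ring_nf
  have hX₂ : x ^ (-2 - α) = X / x ^ 2 := by
    rw [hX, ← Real.rpow_sub_natCast hx.ne']; push_cast; ring_nf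
  have hY₁ : x ^ (1 - α) = x * X := by
    rw [hX, ← pow_mul_rpow_of_add_eq (p := -α) (q := 1 - α) (m := 1) hx (by push_cast; ring), pow_one]
  have hY₂ : x ^ (2 - α) = x ^ 2 * X := by
    rw [hX, ← pow_mul_rpow_of_add_eq (p := -α) (q := 2 - α) (m := 2) hx (by push_cast; ring)]
  rw [hrx, hr₁x, hr₁, hI, hX₁, hX₂, ← hX] at hR
  rw [show 1 - (1 + α) = -α by ring, show -(1 + α) - 1 = -2 - α by ring, hX₂, ← hX] at hQ₀
  rw [show -α - 1 = -1 - α by ring, hX₁, hY₁, ← hX] at hQ₁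
  rw [show 1 - (α - 1) = 2 - α by ring, show -(α - 1) - 1 = -α by ring, hY₂, ← hX,
    show x ^ (-(α - 1)) = x * X by rw [← hY₁]; ring_nf] at hQ₂
  rw [show x ^ (-(1 + α)) = X / x by rw [← hX₁]; ring_nf] at hQ₀
  have hH : 1 / (Real.Gamma (-α) * h ^ α) = 1 / Real.Gamma (-α) * h ^ (-α) := by
    rw [Real.rpow_neg hh.le, one_div, mul_inv, one_div]
  have hH₁ : h ^ (1 - α) = h * h ^ (-α) := by
    rw [← pow_mul_rpow_of_add_eq (p := -α) (q := 1 - α) (m := 1) hh (by push_cast; ring), pow_one]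
  have hH₂ : h ^ (2 - α) = h ^ 2 * h ^ (-α) := by
    rw [← pow_mul_rpow_of_add_eq (p := -α) (q := 2 - α) (m := 2) hh (by push_cast; ring)]
  have bound : ∀ {g R Q₀ Q₁ Q₂ : ℝ}, |R| ≤ C * h ^ (3 - α) → |Q₀| ≤ C₀ * h ^ (3 - α) →
      |Q₁| ≤ C₁ * h ^ (3 - α) → |Q₂| ≤ C₂ * h ^ (3 - α) →
      |g * (R + f₀ * Q₀ + f₁ * Q₁ + f₂ / 2 * Q₂)| ≤
        (|g| * (C + |f₀| * C₀ + |f₁| * C₁ + |f₂ / 2| * C₂) + 1) * h ^ (3 - α) := by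
    intro g R Q₀ Q₁ Q₂ h_R h₀ h₁ h₂
    have tri : |R + f₀ * Q₀ + f₁ * Q₁ + f₂ / 2 * Q₂| ≤
        |R| + |f₀| * |Q₀| + |f₁| * |Q₁| + |f₂ / 2| * |Q₂| := by
      simpa only [abs_mul] using (abs_add_le _ _).trans
        (add_le_add_left (abs_add_three R (f₀ * Q₀) (f₁ * Q₁)) |f₂ / 2 * Q₂|)
    calc |g * (R + f₀ * Q₀ + f₁ * Q₁ + f₂ / 2 * Q₂)|
        ≤ |g| * (C * h ^ (3 - α) + |f₀| * (C₀ * h ^ (3 - α)) + |f₁| * (C₁ * h ^ (3 - α))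
            + |f₂ / 2| * (C₂ * h ^ (3 - α))) := by
          rw [abs_mul]
          refine mul_le_mul_of_nonneg_left (tri.trans ?_) (abs_nonneg g)
          gcongr
      _ ≤ _ := by linarith [Real.rpow_pos_of_pos hh (3 - α)]
  refine (congrArg abs ?_).trans_le (bound (g := 1 / Real.Gamma (-α)) hR hQ₀ hQ₁ hQ₂)
  rw [hH, caputo_eq_integral_mul_rpow_neg hα0 hx, ← hf₀, ← hf₂,
    show deriv y x = -f₁ by rw [hf₁, neg_neg]]
  rw [hH₁, hH₂] at hsum
  rw [hH₁, hH₂]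
  generalize ∫ τ in (0 : ℝ)..x, deriv y (x - τ) * τ ^ (-α) = J
  generalize h ^ (-α) = H at *
  generalize ∑ k ∈ Finset.Icc 1 (n - 1), y (x - (k : ℝ) * h) / (k : ℝ) ^ (1 + α) = S at *
  generalize ∑ k ∈ Finset.Icc 1 (n - 1), r (k * h) * (k * h) ^ (-1 - α) = T at *
  have hα : 1 - α ≠ 0 := by linarith
  have hα' : 2 - α ≠ 0 := by linarith
  rw [mul_sub (1 / Real.Gamma (-α) * H), mul_assoc _ H S, hsum]
  generalize Real.Gamma (-α) = Γ
  field_simp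
  ring
end

section
/- Let 0 < α < 1, x > 0, n ≥ 3 an integer, h = x/n, and define the weights σ̄₀ = ζ(α) − ζ(1+α), σ̄₁ = 1 − ζ(α), σ̄_k = k^{−1−α} for 2 ≤ k ≤ n−1, σ̄_n = ζ(1+α) − Σ_{k=1}^{n−1} k^{−1−α}. Then for the function y(t) = t one has the exact identity (1/(Γ(−α)h^α)) Σ_{k=0}^{n} σ̄_k (x − kh) − x^{1−α}/Γ(2−α) = (h^{1−α}/Γ(−α)) · ( n S_n[α+1] − S_n[α] + n^{1−α}/(α(1−α)) ), where S_n[β] = Σ_{k=1}^{n−1} k^{−β} − ζ(β). (Note x^{1−α}/Γ(2−α) is the Caputo derivative of order α of y(t) = t evaluated at x.) -/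
theorem Gamma_two_sub_eq_mul_Gamma_neg {α : ℝ} (hα0 : α ≠ 0) (hα1 : α ≠ 1) :
    Real.Gamma (2 - α) = (1 - α) * (-α) * Real.Gamma (-α) := by
  rw [show 2 - α = (1 - α) + 1 by ring, Real.Gamma_add_one (sub_ne_zero.mpr hα1.symm),
    show 1 - α = -α + 1 by ring, Real.Gamma_add_one (neg_ne_zero.mpr hα0)]
  ring

theorem sum_Icc_one_eq_add_sum_Icc_two {m : ℕ} (hm : 1 ≤ m) (f : ℕ → ℝ) :
    ∑ k ∈ Finset.Icc 1 m, f k = f 1 + ∑ k ∈ Finset.Icc 2 m, f k :=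
  (Finset.add_sum_Ioc_eq_sum_Icc hm).symm

theorem sum_rpow_neg_one_sub_mul_sub (α h c : ℝ) (m : ℕ) :
    ∑ k ∈ Finset.Icc 2 m, (k : ℝ) ^ (-1 - α) * (c * h - k * h)
      = h * (c * ∑ k ∈ Finset.Icc 2 m, (k : ℝ) ^ (-(α + 1))
          - ∑ k ∈ Finset.Icc 2 m, (k : ℝ) ^ (-α)) := by
  rw [Finset.mul_sum, ← Finset.sum_sub_distrib, Finset.mul_sum]
  refine Finset.sum_congr rfl fun k hk => ?_
  have hk0 : (k : ℝ) ≠ 0 := by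
    have := (Finset.mem_Icc.mp hk).1
    positivity
  rw [show -α = -(α + 1) + 1 by ring, Real.rpow_add_one hk0,
    show -1 - α = -(α + 1) by ring]
  ring


/-- `S_n[β] = Σ_{k=1}^{n−1} k^{−β} − ζ(β)`. -/
noncomputable def S (n : ℕ) (β : ℝ) : ℝ :=
  (∑ k ∈ Finset.Icc 1 (n - 1), (k:ℝ) ^ (-β)) - zr β

theorem Asigmabar_power_neg_one_sub_alpha_on_linear
    (α x : ℝ) (hα0 : 0 < α) (hα1 : α < 1) (hx : 0 < x)
    (n : ℕ) (hn : 3 ≤ n) :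
    (1 / (Real.Gamma (-α) * (x / n) ^ α)) *
        ((zr α - zr (1 + α)) * x
          + (1 - zr α) * (x - x / n)
          + (∑ k ∈ Finset.Icc 2 (n - 1), (k:ℝ) ^ (-1 - α) * (x - (k:ℝ) * (x / n)))
          + (zr (1 + α) - ∑ k ∈ Finset.Icc 1 (n - 1), (k:ℝ) ^ (-1 - α)) *
              (x - (n:ℝ) * (x / n)))
      - x ^ (1 - α) / Real.Gamma (2 - α)
    = ((x / n) ^ (1 - α) / Real.Gamma (-α)) *
        ((n:ℝ) * S n (α + 1) - S n α + (n:ℝ) ^ (1 - α) / (α * (1 - α))) := by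
  have hn0 : (0 : ℝ) < n := by positivity
  obtain ⟨h, rfl⟩ : ∃ h, x = n * h := ⟨x / n, by field_simp⟩
  have hh : 0 < h := pos_of_mul_pos_right hx hn0.le
  have hΓ : Real.Gamma (-α) ≠ 0 := by
    intro h0
    have hpos := Real.Gamma_pos_of_pos (show 0 < 2 - α by linarith)
    rw [Gamma_two_sub_eq_mul_Gamma_neg hα0.ne' hα1.ne, h0] at hpos
    simp at hpos
  have hα1' : 1 - α ≠ 0 := by linarith
  have hpow : h ^ (1 - α) = h / h ^ α := by rw [Real.rpow_sub hh, Real.rpow_one]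
  have hhα : h ^ α ≠ 0 := (Real.rpow_pos_of_pos hh α).ne'
  rw [mul_div_cancel_left₀ h hn0.ne', Gamma_two_sub_eq_mul_Gamma_neg hα0.ne' hα1.ne,
    Real.mul_rpow hn0.le hh.le, sum_rpow_neg_one_sub_mul_sub, hpow, S, S,
    sum_Icc_one_eq_add_sum_Icc_two (by omega) fun k => (k : ℝ) ^ (-(α + 1)),
    sum_Icc_one_eq_add_sum_Icc_two (by omega) fun k => (k : ℝ) ^ (-α),
    add_comm α 1, sub_self, mul_zero]
  simp only [Nat.cast_one, Real.one_rpow]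
  field_simp
  ring
end
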